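/- Let z be a nonzero element of the odd part of sl(1|1) and let ⟨z⟩ denote the rank 1 subalgebra of sl(1|1) generated by z. Then the group of endotrivial modules T(⟨z⟩) is isomorphic to Z/2Z. -/

import Mathlib

/-!
A concrete model of the supermodule categories of the paper "On Endotrivial
Modules for Lie Superalgebras" attached to the detecting subalgebras
`e_r = q(1)^{×r}`, `f_n = sl(1|1)^{×n}`, to rank-one subalgebras `⟨z⟩` of
`sl(1|1)`, and to the exterior superalgebras `V(a_r) = Λ((a_r)₁)`.

A `GSupMod k ι` is a finite-dimensional `ℤ₂`-graded `k`-vector space together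
with a family of odd operators `θ i` (the actions of the distinguished odd
basis elements of the superalgebra: the `e_i` for `e_r`, the `x_i, y_i` for
`f_n`, the `a_i` for `V(a_r)`).  The even parts of all these superalgebras are
generated by the brackets of the odd generators, so the relations defining
each particular category, as well as complete reducibility over the even part,
are imposed by a predicate `𝒞 : GSupMod k ι → Prop`, defined separately for
each case.  All categorical notions (homomorphisms, isomorphisms, direct sums,
tensor products, duals, internal Hom, trivial modules, projectivity,
projective covers and injective hulls, syzygies `Ωⁿ` for `n : ℤ`, endotrivial
modules, and the group `T` of stable classes of endotrivial modules) are
defined relative to such a predicate.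
-/

noncomputable section

namespace SupCat

open Submodule

/-- A finite-dimensional `ℤ₂`-graded `k`-vector space with a family of odd
operators `θ i`, indexed by `ι` (the underlying data of a supermodule over a
superalgebra whose odd part has a distinguished basis indexed by `ι`). -/
structure GSupMod (k : Type) [Field k] (ι : Type) : Type 1 where
  carrier : Type
  [isAddCommGroup : AddCommGroup carrier]
  [isModule : Module k carrier]
  [isFinite : FiniteDimensional k carrier]
  /-- the even component -/
  ev : Submodule k carrier
  /-- the odd component -/
  od : Submodule k carrier
  isCompl : IsCompl ev od
  /-- the (odd) actions of the distinguished odd basis elements -/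
  θ : ι → (carrier →ₗ[k] carrier)
  θ_ev : ∀ i, ∀ m ∈ ev, θ i m ∈ od
  θ_od : ∀ i, ∀ m ∈ od, θ i m ∈ ev

attribute [instance] GSupMod.isAddCommGroup GSupMod.isModule GSupMod.isFinite

namespace GSupMod

variable {k : Type} [Field k] {ι : Type}

/-- The action of a general odd element `v = ∑ v i • (basis element i)`. -/
def actOf [Fintype ι] (M : GSupMod k ι) (v : ι → k) : M.carrier →ₗ[k] M.carrier :=
  ∑ i, v i • M.θ i

/-- The grading involution `σ` of a supermodule: `+1` on the even part and
`-1` on the odd part. -/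
def sigma (M : GSupMod k ι) : M.carrier →ₗ[k] M.carrier :=
  M.ev.subtype ∘ₗ Submodule.linearProjOfIsCompl M.ev M.od M.isCompl
    - M.od.subtype ∘ₗ Submodule.linearProjOfIsCompl M.od M.ev M.isCompl.symm

/-- `f` is a homomorphism of supermodules (an equivariant linear map of
degree `0̄`). -/
def IsHom (M N : GSupMod k ι) (f : M.carrier →ₗ[k] N.carrier) : Prop :=
  (∀ i, f ∘ₗ M.θ i = N.θ i ∘ₗ f) ∧
  (∀ m ∈ M.ev, f m ∈ N.ev) ∧ (∀ m ∈ M.od, f m ∈ N.od)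

/-- `M ≅ N` as supermodules. -/
def Iso (M N : GSupMod k ι) : Prop :=
  ∃ e : M.carrier ≃ₗ[k] N.carrier, IsHom M N (e : M.carrier →ₗ[k] N.carrier)

/-- `S` is (isomorphic to) the direct sum `A ⊕ B`. -/
def IsDsum (A B S : GSupMod k ι) : Prop :=
  ∃ φ : S.carrier ≃ₗ[k] A.carrier × B.carrier,
    (∀ s, s ∈ S.ev ↔ (φ s).1 ∈ A.ev ∧ (φ s).2 ∈ B.ev) ∧
    (∀ s, s ∈ S.od ↔ (φ s).1 ∈ A.od ∧ (φ s).2 ∈ B.od) ∧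
    ∀ (i : ι) (s : S.carrier),
      φ (S.θ i s) = LinearMap.prodMap (A.θ i) (B.θ i) (φ s)

/-- `M` is (isomorphic to) the trivial supermodule of parity `p`: `k_ev`
for `p = false`, and `k_od = Π(k_ev)` for `p = true`. -/
def IsTrivial (p : Bool) (M : GSupMod k ι) : Prop :=
  Module.finrank k M.carrier = 1 ∧ (∀ i, M.θ i = 0) ∧
    (if p then M.od = ⊤ else M.ev = ⊤)

/-- `M` is indecomposable. -/
def Indecomposable (M : GSupMod k ι) : Prop :=
  (∃ m : M.carrier, m ≠ 0) ∧
  ∀ A B : GSupMod k ι, IsDsum A B M →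
    (∀ a : A.carrier, a = 0) ∨ (∀ b : B.carrier, b = 0)

/-- `M` is a simple supermodule: nonzero, with no proper nonzero graded
invariant submodule. -/
def IsSimple (M : GSupMod k ι) : Prop :=
  (∃ m : M.carrier, m ≠ 0) ∧
  ∀ N : Submodule k M.carrier,
    (∀ i, ∀ m ∈ N, M.θ i m ∈ N) →
    N = (N ⊓ M.ev) ⊔ (N ⊓ M.od) →
    N = ⊥ ∨ N = ⊤

variable (𝒞 : GSupMod k ι → Prop)

/-- `P` is a projective object of the category cut out by `𝒞` (defined by the
lifting property). -/
def IsProjective (P : GSupMod k ι) : Prop :=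
  𝒞 P ∧
  ∀ (M N : GSupMod k ι) (π : M.carrier →ₗ[k] N.carrier)
    (f : P.carrier →ₗ[k] N.carrier),
    𝒞 M → 𝒞 N → IsHom M N π → Function.Surjective π → IsHom P N f →
    ∃ h : P.carrier →ₗ[k] M.carrier, IsHom P M h ∧ π ∘ₗ h = f

/-- `I` is an injective object of the category cut out by `𝒞`. -/
def IsInjective (I : GSupMod k ι) : Prop :=
  𝒞 I ∧
  ∀ (M N : GSupMod k ι) (j : M.carrier →ₗ[k] N.carrier)
    (f : M.carrier →ₗ[k] I.carrier),
    𝒞 M → 𝒞 N → IsHom M N j → Function.Injective j → IsHom M I f →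
    ∃ h : N.carrier →ₗ[k] I.carrier, IsHom N I h ∧ h ∘ₗ j = f

/-- `π : P ↠ M` is a projective cover. -/
def IsProjCover (P M : GSupMod k ι) (π : P.carrier →ₗ[k] M.carrier) : Prop :=
  IsProjective 𝒞 P ∧ IsHom P M π ∧ Function.Surjective π ∧
  ∀ (Q : GSupMod k ι) (f : Q.carrier →ₗ[k] P.carrier),
    𝒞 Q → IsHom Q P f → Function.Surjective (π ∘ₗ f) → Function.Surjective f

/-- `j : M ↪ I` is an injective hull. -/
def IsInjHull (M I : GSupMod k ι) (j : M.carrier →ₗ[k] I.carrier) : Prop :=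
  IsInjective 𝒞 I ∧ IsHom M I j ∧ Function.Injective j ∧
  ∀ (Q : GSupMod k ι) (f : I.carrier →ₗ[k] Q.carrier),
    𝒞 Q → IsHom I Q f → Function.Injective (f ∘ₗ j) → Function.Injective f

/-- `N` is (isomorphic to) the first syzygy `Ω¹(M)`, the kernel of a
projective cover of `M`. -/
def IsSyzygy (M N : GSupMod k ι) : Prop :=
  𝒞 N ∧
  ∃ (P : GSupMod k ι) (π : P.carrier →ₗ[k] M.carrier)
    (i : N.carrier →ₗ[k] P.carrier),
    IsProjCover 𝒞 P M π ∧ IsHom N P i ∧ Function.Injective i ∧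
    LinearMap.range i = LinearMap.ker π

/-- `N` is (isomorphic to) the first cosyzygy `Ω⁻¹(M)`, the cokernel of the
inclusion of `M` into its injective hull. -/
def IsCosyzygy (M N : GSupMod k ι) : Prop :=
  𝒞 N ∧
  ∃ (I : GSupMod k ι) (j : M.carrier →ₗ[k] I.carrier)
    (p : I.carrier →ₗ[k] N.carrier),
    IsInjHull 𝒞 M I j ∧ IsHom I N p ∧ Function.Surjective p ∧
    LinearMap.ker p = LinearMap.range j

/-- `M` has no nonzero projective direct summand (equivalently, since the
category is self-injective, no nonzero projective submodule). -/
def NoProjSummands (M : GSupMod k ι) : Prop :=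
  ∀ A B : GSupMod k ι, IsProjective 𝒞 A → IsDsum A B M → ∀ a : A.carrier, a = 0

/-- `N` is (isomorphic to) `Ω⁰(M)`, the complement of the largest projective
direct summand of `M`. -/
def IsOmegaZero (M N : GSupMod k ι) : Prop :=
  ∃ Q : GSupMod k ι, IsProjective 𝒞 Q ∧ NoProjSummands 𝒞 N ∧ IsDsum N Q M

/-- `N` is (isomorphic to) `Ωⁿ(M)` for `n ∈ ℕ`. -/
def IsOmegaPow : ℕ → GSupMod k ι → GSupMod k ι → Prop
  | 0, M, N => IsOmegaZero 𝒞 M N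
  | n+1, M, N => ∃ L, IsOmegaPow n M L ∧ IsSyzygy 𝒞 L N

/-- `N` is (isomorphic to) `Ω⁻ⁿ(M)` for `n ∈ ℕ`. -/
def IsOmegaNegPow : ℕ → GSupMod k ι → GSupMod k ι → Prop
  | 0, M, N => IsOmegaZero 𝒞 M N
  | n+1, M, N => ∃ L, IsOmegaNegPow n M L ∧ IsCosyzygy 𝒞 L N

/-- `N` is (isomorphic to) the syzygy `Ωⁿ(M)`, for any `n : ℤ`. -/
def IsOmega (n : ℤ) (M N : GSupMod k ι) : Prop :=
  if 0 ≤ n then IsOmegaPow 𝒞 n.toNat M N else IsOmegaNegPow 𝒞 (-n).toNat M N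

/-- `H` is (isomorphic to) the internal Hom supermodule `Hom_k(M,N)` with its
usual grading and the super action of the odd generators
`(θ i · f)(m) = θ i (f m) - (-1)^{|f|} f (θ i m)` (the sign `(-1)^{|f|}` is
expressed via the grading involutions `σ`). -/
def IsHomObj (M N H : GSupMod k ι) : Prop :=
  ∃ φ : H.carrier ≃ₗ[k] (M.carrier →ₗ[k] N.carrier),
    (∀ h, h ∈ H.ev ↔ ((∀ m ∈ M.ev, φ h m ∈ N.ev) ∧ (∀ m ∈ M.od, φ h m ∈ N.od))) ∧
    (∀ h, h ∈ H.od ↔ ((∀ m ∈ M.ev, φ h m ∈ N.od) ∧ (∀ m ∈ M.od, φ h m ∈ N.ev))) ∧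
    ∀ (i : ι) (h : H.carrier),
      φ (H.θ i h) = N.θ i ∘ₗ φ h - (N.sigma ∘ₗ φ h ∘ₗ M.sigma) ∘ₗ M.θ i

/-- `T` is (isomorphic to) the tensor product supermodule `M ⊗_k N` with its
usual grading and the action of the odd generators
`θ i · (m ⊗ n) = (θ i m) ⊗ n + (-1)^{|m|} m ⊗ (θ i n)`. -/
def IsTensorObj (M N T : GSupMod k ι) : Prop :=
  ∃ φ : T.carrier ≃ₗ[k] TensorProduct k M.carrier N.carrier,
    Submodule.map (φ : T.carrier →ₗ[k] TensorProduct k M.carrier N.carrier) T.ev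
      = Submodule.span k
          ({z | ∃ m ∈ M.ev, ∃ n ∈ N.ev, z = m ⊗ₜ[k] n}
            ∪ {z | ∃ m ∈ M.od, ∃ n ∈ N.od, z = m ⊗ₜ[k] n}) ∧
    Submodule.map (φ : T.carrier →ₗ[k] TensorProduct k M.carrier N.carrier) T.od
      = Submodule.span k
          ({z | ∃ m ∈ M.ev, ∃ n ∈ N.od, z = m ⊗ₜ[k] n}
            ∪ {z | ∃ m ∈ M.od, ∃ n ∈ N.ev, z = m ⊗ₜ[k] n}) ∧
    ∀ (i : ι) (t : T.carrier),
      φ (T.θ i t)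
        = TensorProduct.map (M.θ i) (LinearMap.id : N.carrier →ₗ[k] N.carrier) (φ t)
            + TensorProduct.map M.sigma (N.θ i) (φ t)

/-- `D` is (isomorphic to) the dual supermodule `M* = Hom_k(M, k_ev)`, with
the action `(θ i · ψ)(m) = -(-1)^{|ψ|} ψ (θ i m)`. -/
def IsDualObj (M D : GSupMod k ι) : Prop :=
  ∃ φ : D.carrier ≃ₗ[k] Module.Dual k M.carrier,
    (∀ d, d ∈ D.ev ↔ ∀ m ∈ M.od, φ d m = 0) ∧
    (∀ d, d ∈ D.od ↔ ∀ m ∈ M.ev, φ d m = 0) ∧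
    ∀ (i : ι) (d : D.carrier),
      φ (D.θ i d) = - (φ d) ∘ₗ (M.sigma ∘ₗ M.θ i)

/-- `M` is an endotrivial supermodule of the category cut out by `𝒞`:
`Hom_k(M,M) ≅ k_ev ⊕ P` with `P` projective. -/
def IsEndotrivial (M : GSupMod k ι) : Prop :=
  𝒞 M ∧
  ∃ H K P S : GSupMod k ι, IsHomObj M M H ∧ 𝒞 H ∧ IsTrivial false K ∧
    IsProjective 𝒞 P ∧ IsDsum K P S ∧ Iso H S

/-- `M` and `N` are isomorphic in the stable module category: they become
isomorphic after adding projective direct summands. -/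
def StIso (M N : GSupMod k ι) : Prop :=
  ∃ P Q S T : GSupMod k ι, IsProjective 𝒞 P ∧ IsProjective 𝒞 Q ∧
    IsDsum M P S ∧ IsDsum N Q T ∧ Iso S T

/-- `R` is (isomorphic to) the restriction of `M` along the subalgebra of the
odd space spanned by the vectors `ε j`: the same underlying graded vector
space, where the `j`-th odd generator acts as the element `ε j` did on `M`. -/
def IsRestriction {ι' : Type} [Fintype ι] (ε : ι' → ι → k)
    (M : GSupMod k ι) (R : GSupMod k ι') : Prop :=
  ∃ φ : R.carrier ≃ₗ[k] M.carrier,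
    (∀ m, m ∈ R.ev ↔ φ m ∈ M.ev) ∧
    (∀ m, m ∈ R.od ↔ φ m ∈ M.od) ∧
    ∀ (j : ι') (m : R.carrier), φ (R.θ j m) = actOf M (ε j) (φ m)

/-- The radical `Rad(M)` of a supermodule over one of the detecting
superalgebras on the principal block: the span of the images of the odd
generators. -/
def radical (M : GSupMod k ι) : Submodule k M.carrier :=
  ⨆ i, LinearMap.range (M.θ i)

/-- The rank `Rk(M) = dim_k (M / Rad M)`. -/
def rk (M : GSupMod k ι) : ℕ :=
  Module.finrank k (M.carrier ⧸ radical M)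

end GSupMod

open GSupMod

variable {k : Type} [Field k]

/-- The category of supermodules (in the principal block) over the exterior
superalgebra `V(a_r) = Λ((a_r)₁)` on the purely odd abelian `r`-dimensional
space `(a_r)₁`: the odd generators pairwise super-anticommute (in particular
they square to zero).  Complete reducibility over the even part is automatic
since the even part acts by zero. -/
def VCat (k : Type) [Field k] (r : ℕ) : GSupMod k (Fin r) → Prop :=
  fun M => ∀ i j, M.θ i ∘ₗ M.θ j + M.θ j ∘ₗ M.θ i = 0

/-- The relation on endotrivial supermodules inducing the group `T`: stable
isomorphism. -/
def TRel {ι : Type} (𝒞 : GSupMod k ι → Prop) :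
    {M : GSupMod k ι // IsEndotrivial 𝒞 M} →
    {M : GSupMod k ι // IsEndotrivial 𝒞 M} → Prop :=
  fun M N => StIso 𝒞 M.1 N.1

/-- The underlying set of the group `T`: stable isomorphism classes of
endotrivial supermodules. -/
def TGrp {ι : Type} (𝒞 : GSupMod k ι → Prop) : Type 1 := Quot (TRel 𝒞)

/-- The stable class of an endotrivial supermodule. -/
def tmk {ι : Type} (𝒞 : GSupMod k ι → Prop)
    (M : {M : GSupMod k ι // IsEndotrivial 𝒞 M}) : TGrp 𝒞 :=
  Quot.mk (TRel 𝒞) M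

/-- An abelian group structure on `T` whose multiplication, identity and
inverse are induced by tensor product, the trivial module `k_ev` and duality
respectively. -/
structure TGroupData {ι : Type} (𝒞 : GSupMod k ι → Prop) : Type 1 where
  mul : TGrp 𝒞 → TGrp 𝒞 → TGrp 𝒞
  one : TGrp 𝒞
  inv : TGrp 𝒞 → TGrp 𝒞
  mul_assoc : ∀ a b c, mul (mul a b) c = mul a (mul b c)
  mul_comm : ∀ a b, mul a b = mul b a
  one_mul : ∀ a, mul one a = a
  inv_mul : ∀ a, mul (inv a) a = one
  mul_spec : ∀ (M N : {M : GSupMod k ι // IsEndotrivial 𝒞 M}) (T : GSupMod k ι)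
      (_ : IsTensorObj M.1 N.1 T) (hT : IsEndotrivial 𝒞 T),
      mul (tmk 𝒞 M) (tmk 𝒞 N) = tmk 𝒞 ⟨T, hT⟩
  one_spec : ∀ (K : GSupMod k ι) (_ : IsTrivial false K) (hK : IsEndotrivial 𝒞 K),
      one = tmk 𝒞 ⟨K, hK⟩
  inv_spec : ∀ (M : {M : GSupMod k ι // IsEndotrivial 𝒞 M}) (D : GSupMod k ι)
      (_ : IsDualObj M.1 D) (hD : IsEndotrivial 𝒞 D),
      inv (tmk 𝒞 M) = tmk 𝒞 ⟨D, hD⟩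

end SupCat

namespace SupCat

variable {k : Type} [Field k]

/-- The category `F(⟨z⟩) = F_(⟨z⟩, ⟨z⟩₀)` for the rank one subalgebra
`⟨z⟩ ⊆ sl(1|1)` generated by a nonzero odd element `z = a•x + b•y`.  In
`U(⟨z⟩)` one has `z² = ½[z,z] = ab·t`, so a `⟨z⟩`-supermodule is a graded
space with one odd operator (the action of `z`), and complete reducibility
over the even part `⟨z⟩₀ = ⟨[z,z]⟩` says that every `z²`-invariant submodule
has a `z²`-invariant complement; when `ab = 0` the relation `z² = 0` holds.
The parameter `c` stands for the product `a·b`. -/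
def ZCat (k : Type) [Field k] (c : k) : GSupMod k (Fin 1) → Prop := fun M =>
  (∀ N : Submodule k M.carrier, (∀ m ∈ N, M.θ 0 (M.θ 0 m) ∈ N) →
    ∃ N' : Submodule k M.carrier,
      (∀ m ∈ N', M.θ 0 (M.θ 0 m) ∈ N') ∧ IsCompl N N') ∧
  (c = 0 → M.θ 0 ∘ₗ M.θ 0 = 0)

end SupCat

namespace SupCat

open GSupMod

section Basic

variable {k : Type} [Field k]

theorem sigma_of_ev {M : GSupMod k (Fin 1)} {m : M.carrier} (h : m ∈ M.ev) :
    M.sigma m = m := by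
  have h2 : Submodule.projectionOnto M.od M.ev M.isCompl.symm m = 0 :=
    (Submodule.projectionOnto_apply_eq_zero_iff _).2 h
  have h1 : Submodule.projectionOnto M.ev M.od M.isCompl m = ⟨m, h⟩ :=
    Submodule.projectionOnto_apply_of_mem_left _ h
  change ((Submodule.projectionOnto M.ev M.od M.isCompl m : M.ev) : M.carrier) -
    ((Submodule.projectionOnto M.od M.ev M.isCompl.symm m : M.od) : M.carrier) = m
  rw [h1, h2]; simp

theorem sigma_of_od {M : GSupMod k (Fin 1)} {m : M.carrier} (h : m ∈ M.od) :
    M.sigma m = -m := by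
  have h2 : Submodule.projectionOnto M.ev M.od M.isCompl m = 0 :=
    (Submodule.projectionOnto_apply_eq_zero_iff _).2 h
  have h1 : Submodule.projectionOnto M.od M.ev M.isCompl.symm m = ⟨m, h⟩ :=
    Submodule.projectionOnto_apply_of_mem_left _ h
  change ((Submodule.projectionOnto M.ev M.od M.isCompl m : M.ev) : M.carrier) -
    ((Submodule.projectionOnto M.od M.ev M.isCompl.symm m : M.od) : M.carrier) = -m
  rw [h1, h2]; simp

theorem par_decomp (M : GSupMod k (Fin 1)) (m : M.carrier) :
    ∃ a ∈ M.ev, ∃ b ∈ M.od, m = a + b := by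
  have : m ∈ M.ev ⊔ M.od := by rw [M.isCompl.sup_eq_top]; trivial
  obtain ⟨a, ha, b, hb, h⟩ := Submodule.mem_sup.1 this
  exact ⟨a, ha, b, hb, h.symm⟩

theorem par_ext {M : GSupMod k (Fin 1)} {X : Type*} [AddCommGroup X] [Module k X]
    (f g : M.carrier →ₗ[k] X) (h0 : ∀ m ∈ M.ev, f m = g m) (h1 : ∀ m ∈ M.od, f m = g m)
    (m : M.carrier) : f m = g m := by
  obtain ⟨a, ha, b, hb, rfl⟩ := par_decomp M m
  rw [map_add, map_add, h0 a ha, h1 b hb]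

theorem sigma_sigma (M : GSupMod k (Fin 1)) (m : M.carrier) : M.sigma (M.sigma m) = m := by
  obtain ⟨a, ha, b, hb, rfl⟩ := par_decomp M m
  simp [sigma_of_ev ha, sigma_of_od hb]

theorem sigma_theta (M : GSupMod k (Fin 1)) (m : M.carrier) :
    M.sigma (M.θ 0 m) = - M.θ 0 (M.sigma m) := by
  obtain ⟨a, ha, b, hb, rfl⟩ := par_decomp M m
  simp [sigma_of_ev ha, sigma_of_od hb, sigma_of_ev (M.θ_od 0 b hb), sigma_of_od (M.θ_ev 0 a ha), add_comm]

variable [CharZero k]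

theorem eq_zero_of_eq_neg {V : Type*} [AddCommGroup V] [Module k V] {v : V} (h : v = -v) :
    v = 0 := by
  have h2 : (2 : k) • v = 0 := by
    rw [two_smul]; nth_rewrite 2 [h]; simp
  exact (smul_eq_zero.1 h2).resolve_left two_ne_zero

theorem mem_ev_iff (M : GSupMod k (Fin 1)) (m : M.carrier) : m ∈ M.ev ↔ M.sigma m = m := by
  refine ⟨sigma_of_ev, fun h => ?_⟩
  obtain ⟨a, ha, b, hb, rfl⟩ := par_decomp M m
  rw [map_add, sigma_of_ev ha, sigma_of_od hb] at h
  have : b = 0 := eq_zero_of_eq_neg (k := k) (add_left_cancel h).symm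
  simpa [this] using ha

theorem mem_od_iff (M : GSupMod k (Fin 1)) (m : M.carrier) : m ∈ M.od ↔ M.sigma m = -m := by
  refine ⟨sigma_of_od, fun h => ?_⟩
  obtain ⟨a, ha, b, hb, rfl⟩ := par_decomp M m
  rw [map_add, sigma_of_ev ha, sigma_of_od hb, neg_add] at h
  have : a = 0 := eq_zero_of_eq_neg (k := k) (add_right_cancel h)
  simpa [this] using hb

theorem isHom_iff (M N : GSupMod k (Fin 1)) (f : M.carrier →ₗ[k] N.carrier) :
    IsHom M N f ↔ (∀ m, f (M.θ 0 m) = N.θ 0 (f m)) ∧ ∀ m, f (M.sigma m) = N.sigma (f m) := by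
  constructor
  · rintro ⟨h, h0, h1⟩
    refine ⟨fun m => LinearMap.congr_fun (h 0) m, fun m => ?_⟩
    refine par_ext (f ∘ₗ M.sigma) (N.sigma ∘ₗ f) ?_ ?_ m
    · intro m hm; simp [sigma_of_ev hm, sigma_of_ev (h0 m hm)]
    · intro m hm; simp [sigma_of_od hm, sigma_of_od (h1 m hm)]
  · rintro ⟨h, hs⟩
    refine ⟨fun i => ?_, fun m hm => ?_, fun m hm => ?_⟩
    · obtain rfl : i = 0 := Subsingleton.elim _ _
      ext m; exact h m
    · rw [mem_ev_iff] at hm ⊢; rw [← hs, hm]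
    · rw [mem_od_iff] at hm ⊢; rw [← hs, hm, map_neg]

/-- Build a supermodule from its grading involution. -/
def mkS (V : Type) [AddCommGroup V] [Module k V] [FiniteDimensional k V]
    (s t : V →ₗ[k] V) (hs : ∀ v, s (s v) = v) (ht : ∀ v, s (t v) = - t (s v)) :
    GSupMod k (Fin 1) where
  carrier := V
  ev := LinearMap.ker (s - LinearMap.id)
  od := LinearMap.ker (s + LinearMap.id)
  isCompl := by
    constructor
    · rw [Submodule.disjoint_def]
      intro x h0 h1
      simp only [LinearMap.mem_ker, LinearMap.sub_apply, LinearMap.add_apply,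
        LinearMap.id_apply, sub_eq_zero] at h0 h1
      rw [h0] at h1
      exact eq_zero_of_eq_neg (k := k) (eq_neg_of_add_eq_zero_left h1)
    · rw [codisjoint_iff, eq_top_iff]
      intro x _
      refine Submodule.mem_sup.2 ⟨(2⁻¹ : k) • (x + s x), ?_, (2⁻¹ : k) • (x - s x), ?_, ?_⟩
      · simp [hs, add_comm]
      · simp [hs]
      · rw [← smul_add]
        have : x + s x + (x - s x) = (2 : k) • x := by rw [two_smul]; abel
        rw [this, smul_smul, inv_mul_cancel₀ two_ne_zero, one_smul]
  θ := fun _ => t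
  θ_ev := by
    intro _ m hm
    simp only [LinearMap.mem_ker, LinearMap.sub_apply, LinearMap.add_apply,
        LinearMap.id_apply, sub_eq_zero] at hm ⊢
    rw [ht, hm]; simp
  θ_od := by
    intro _ m hm
    simp only [LinearMap.mem_ker, LinearMap.sub_apply, LinearMap.add_apply,
        LinearMap.id_apply, sub_eq_zero] at hm ⊢
    rw [ht, eq_neg_of_add_eq_zero_left hm]; simp

theorem mkS_sigma (V : Type) [AddCommGroup V] [Module k V] [FiniteDimensional k V]
    (s t : V →ₗ[k] V) (hs : ∀ v, s (s v) = v) (ht : ∀ v, s (t v) = - t (s v)) (v : V) :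
    (mkS V s t hs ht).sigma v = s v := by
  refine par_ext (M := mkS V s t hs ht) (mkS V s t hs ht).sigma s ?_ ?_ v
  · intro m hm
    rw [sigma_of_ev hm]
    have hm' : (s - LinearMap.id : V →ₗ[k] V) m = 0 := hm
    exact (sub_eq_zero.1 hm').symm
  · intro m hm
    rw [sigma_of_od hm]
    have hm' : (s + LinearMap.id : V →ₗ[k] V) m = 0 := hm
    exact (eq_neg_of_add_eq_zero_left hm').symm

theorem isDsum_of (A B S : GSupMod k (Fin 1))
    (φ : S.carrier ≃ₗ[k] A.carrier × B.carrier)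
    (h1 : ∀ s, φ (S.sigma s) = (A.sigma (φ s).1, B.sigma (φ s).2))
    (h2 : ∀ s, φ (S.θ 0 s) = (A.θ 0 (φ s).1, B.θ 0 (φ s).2)) : IsDsum A B S := by
  refine ⟨φ, fun s => ?_, fun s => ?_, fun i s => ?_⟩
  · rw [mem_ev_iff, mem_ev_iff, mem_ev_iff, ← φ.injective.eq_iff, h1, Prod.ext_iff]
  · rw [mem_od_iff, mem_od_iff, mem_od_iff, ← φ.injective.eq_iff, h1, Prod.ext_iff, map_neg]
    rfl
  · obtain rfl : i = 0 := Subsingleton.elim _ _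
    rw [h2]; rfl

theorem isDsum_elim {A B S : GSupMod k (Fin 1)} (h : IsDsum A B S) :
    ∃ φ : S.carrier ≃ₗ[k] A.carrier × B.carrier,
    (∀ s, φ (S.sigma s) = (A.sigma (φ s).1, B.sigma (φ s).2)) ∧
    (∀ s, φ (S.θ 0 s) = (A.θ 0 (φ s).1, B.θ 0 (φ s).2)) := by
  obtain ⟨φ, h0, h1, h2⟩ := h
  refine ⟨φ, fun s => ?_, fun s => ?_⟩
  · refine par_ext (φ.toLinearMap ∘ₗ S.sigma) (LinearMap.prodMap A.sigma B.sigma ∘ₗ φ.toLinearMap)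
      ?_ ?_ s
    · intro m hm
      have := (h0 m).1 hm
      simp only [LinearMap.comp_apply, sigma_of_ev hm, LinearEquiv.coe_coe]
      ext
      · exact (sigma_of_ev this.1).symm
      · exact (sigma_of_ev this.2).symm
    · intro m hm
      have := (h1 m).1 hm
      simp only [LinearMap.comp_apply, sigma_of_od hm, LinearEquiv.coe_coe, map_neg]
      ext
      · exact (sigma_of_od this.1).symm
      · exact (sigma_of_od this.2).symm
  · rw [h2]; rfl

/-- direct sum -/
def dsum (A B : GSupMod k (Fin 1)) : GSupMod k (Fin 1) :=
  mkS (A.carrier × B.carrier) (LinearMap.prodMap A.sigma B.sigma)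
    (LinearMap.prodMap (A.θ 0) (B.θ 0))
    (by rintro ⟨x, y⟩; simp [sigma_sigma]) (by rintro ⟨x, y⟩; simp [sigma_theta])

theorem isDsum_dsum (A B : GSupMod k (Fin 1)) : IsDsum A B (dsum A B) := by
  refine isDsum_of A B _ (LinearEquiv.refl k (A.carrier × B.carrier)) (fun s => ?_) (fun s => ?_)
  · exact mkS_sigma (A.carrier × B.carrier) _ _ _ _ s
  · rfl

/-- sub-supermodule -/
def sub (M : GSupMod k (Fin 1)) (N : Submodule k M.carrier) (hs : ∀ m ∈ N, M.sigma m ∈ N)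
    (ht : ∀ m ∈ N, M.θ 0 m ∈ N) : GSupMod k (Fin 1) :=
  mkS N (M.sigma.restrict hs) ((M.θ 0).restrict ht)
    (by rintro ⟨x, y⟩; ext; simp [sigma_sigma]) (by rintro ⟨x, y⟩; ext; simp [sigma_theta])

end Basic

end SupCat

namespace SupCat

open GSupMod

section Proj

variable {k : Type} [Field k]

theorem aeval_intertwine {V W : Type*} [AddCommGroup V] [Module k V] [AddCommGroup W] [Module k W]
    (T : Module.End k V) (T' : Module.End k W) (f : V →ₗ[k] W) (h : ∀ v, f (T v) = T' (f v))
    (p : Polynomial k) (v : V) : f (Polynomial.aeval T p v) = Polynomial.aeval T' p (f v) := by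
  induction p using Polynomial.induction_on' with
  | add p q hp hq => simp [hp, hq]
  | monomial n a =>
    simp only [Polynomial.aeval_monomial, Module.algebraMap_end_eq_smul_id,
      Module.End.mul_apply, LinearMap.smul_apply, LinearMap.id_apply, map_smul]
    congr 1
    induction n generalizing v with
    | zero => simp
    | succ n ih => rw [pow_succ, pow_succ, Module.End.mul_apply, Module.End.mul_apply, ih, h]

/-- the square of the odd operator -/
def sq (M : GSupMod k (Fin 1)) : Module.End k M.carrier := M.θ 0 ∘ₗ M.θ 0

theorem zcat_iff (c : k) (M : GSupMod k (Fin 1)) :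
    ZCat k c M ↔ (sq M).IsSemisimple ∧ (c = 0 → sq M = 0) := by
  rw [Module.End.isSemisimple_iff]
  rfl

theorem zcat_transfer {c : k} {M N : GSupMod k (Fin 1)} (hM : ZCat k c M)
    (h : ∀ p : Polynomial k, Polynomial.aeval (sq M) p = 0 → Polynomial.aeval (sq N) p = 0) :
    ZCat k c N := by
  rw [zcat_iff] at hM ⊢
  refine ⟨Module.End.isSemisimple_of_squarefree_aeval_eq_zero hM.1.minpoly_squarefree
    (h _ (minpoly.aeval _ _)), fun hc => ?_⟩
  have := h Polynomial.X (by simpa using hM.2 hc)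
  simpa using this

theorem zcat_of_inj {c : k} {M N : GSupMod k (Fin 1)} (hM : ZCat k c M)
    (j : N.carrier →ₗ[k] M.carrier) (hj : Function.Injective j)
    (h : ∀ n, j (N.θ 0 n) = M.θ 0 (j n)) : ZCat k c N := by
  refine zcat_transfer hM fun p hp => ?_
  ext v
  apply hj
  rw [aeval_intertwine (sq N) (sq M) j (fun v => by simp [sq, h]), hp]
  simp

theorem eqv_section {V W : Type*} [AddCommGroup V] [Module k V] [AddCommGroup W] [Module k W]
    (T : V →ₗ[k] V) (T' : W →ₗ[k] W) (f : V →ₗ[k] W) (hf : Function.Surjective f)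
    (h : ∀ v, f (T v) = T' (f v)) (C : Submodule k V) (hC : ∀ c ∈ C, T c ∈ C)
    (hc : IsCompl (LinearMap.ker f) C) :
    ∃ t : W →ₗ[k] V, (∀ w, f (t w) = w) ∧ ∀ w, t (T' w) = T (t w) := by
  have hinj : ∀ c ∈ C, f c = 0 → c = 0 := fun c h1 h2 =>
    Submodule.disjoint_def.1 hc.disjoint c h2 h1
  have hbij : Function.Bijective (f ∘ₗ C.subtype) := by
    constructor
    · rw [← LinearMap.ker_eq_bot, LinearMap.ker_eq_bot']
      rintro ⟨c, h1⟩ h2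
      ext; exact hinj c h1 h2
    · intro w
      obtain ⟨v, rfl⟩ := hf w
      have : v ∈ LinearMap.ker f ⊔ C := by rw [hc.sup_eq_top]; trivial
      obtain ⟨a, ha, b, hb, rfl⟩ := Submodule.mem_sup.1 this
      refine ⟨⟨b, hb⟩, ?_⟩
      rw [LinearMap.mem_ker] at ha
      simp [ha]
  let e := LinearEquiv.ofBijective _ hbij
  have he : ∀ w, f (e.symm w : V) = w := fun w => e.apply_symm_apply w
  refine ⟨C.subtype ∘ₗ e.symm.toLinearMap, he, fun w => ?_⟩
  have h1 : (e.symm (T' w) : V) - T (e.symm w : V) = 0 := by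
    apply hinj
    · exact C.sub_mem (e.symm (T' w)).2 (hC _ (e.symm w).2)
    · rw [map_sub, h, he, he, sub_self]
  exact sub_eq_zero.1 h1

theorem sigma_sq (M : GSupMod k (Fin 1)) (m : M.carrier) :
    M.sigma (sq M m) = sq M (M.sigma m) := by
  simp [sq, sigma_theta]

/-- contractibility -/
def Contr (M : GSupMod k (Fin 1)) : Prop :=
  ∃ s : M.carrier →ₗ[k] M.carrier, ∀ m, M.θ 0 (s m) + s (M.θ 0 m) = m

variable [CharZero k]

theorem half_add_half {V : Type*} [AddCommGroup V] [Module k V] (v : V) :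
    (2⁻¹ : k) • (v + v) = v := by
  rw [← two_smul k, smul_smul, inv_mul_cancel₀ two_ne_zero, one_smul]

theorem Contr.odd {M : GSupMod k (Fin 1)} (h : Contr M) :
    ∃ s : M.carrier →ₗ[k] M.carrier, (∀ m, M.θ 0 (s m) + s (M.θ 0 m) = m) ∧
      ∀ m, M.sigma (s m) = - s (M.sigma m) := by
  obtain ⟨s, hs⟩ := h
  refine ⟨(2⁻¹ : k) • (s - M.sigma ∘ₗ s ∘ₗ M.sigma), fun m => ?_, fun m => ?_⟩
  · have h1 : M.θ 0 (M.sigma (s (M.sigma m))) = - M.sigma (M.θ 0 (s (M.sigma m))) := by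
      rw [sigma_theta, neg_neg]
    have h2 : M.sigma (s (M.sigma (M.θ 0 m))) = - M.sigma (s (M.θ 0 (M.sigma m))) := by
      rw [sigma_theta, map_neg, map_neg]
    have h3 := congrArg M.sigma (hs (M.sigma m))
    rw [map_add, sigma_sigma] at h3
    simp only [LinearMap.smul_apply, LinearMap.sub_apply, LinearMap.comp_apply, map_smul, map_sub]
    rw [← smul_add, h1, h2]
    conv_rhs => rw [← half_add_half (k := k) m]
    congr 1
    calc _ = (M.θ 0 (s m) + s (M.θ 0 m)) + (M.sigma (M.θ 0 (s (M.sigma m))) +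
          M.sigma (s (M.θ 0 (M.sigma m)))) := by abel
      _ = m + m := by rw [hs, h3]
  · simp only [LinearMap.smul_apply, LinearMap.sub_apply, LinearMap.comp_apply, map_smul, map_sub,
      sigma_sigma]
    rw [← smul_neg]; congr 1; abel

theorem isProjective_of_contr {c : k} {P : GSupMod k (Fin 1)} (hP : ZCat k c P) (h : Contr P) :
    IsProjective (ZCat k c) P := by
  obtain ⟨s, hs, hσ⟩ := h.odd
  refine ⟨hP, fun M N π f hM hN hπ hsur hf => ?_⟩
  rw [isHom_iff] at hπ hf
  have hπT : ∀ v, π (sq M v) = sq N (π v) := fun v => by simp [sq, hπ.1]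
  obtain ⟨C, hC, hc⟩ := hM.1 (LinearMap.ker π) (fun m hm => by
    rw [LinearMap.mem_ker] at hm ⊢
    rw [hπ.1, hπ.1, hm]; simp)
  obtain ⟨t, ht, htT⟩ := eqv_section (sq M) (sq N) π hsur hπT C hC hc
  let g0 : N.carrier →ₗ[k] M.carrier := (2⁻¹ : k) • (t + M.sigma ∘ₗ t ∘ₗ N.sigma)
  have hg0 : ∀ n, g0 n = (2⁻¹ : k) • (t n + M.sigma (t (N.sigma n))) := fun n => rfl
  have hg1 : ∀ n, π (g0 n) = n := fun n => by
    rw [hg0, map_smul, map_add, hπ.2, ht, ht, sigma_sigma, half_add_half]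
  have hg2 : ∀ n, g0 (sq N n) = sq M (g0 n) := fun n => by
    rw [hg0, hg0, map_smul, map_add, htT, sigma_sq, htT, sigma_sq]
  have hg3 : ∀ n, g0 (N.sigma n) = M.sigma (g0 n) := fun n => by
    rw [hg0, hg0, map_smul, map_add, sigma_sigma, sigma_sigma, add_comm]
  let g : P.carrier →ₗ[k] M.carrier := g0 ∘ₗ f
  have h1 : ∀ n, π (g n) = f n := fun n => hg1 _
  have h2 : ∀ n, g (P.θ 0 (P.θ 0 n)) = M.θ 0 (M.θ 0 (g n)) := fun n => by
    change g0 (f _) = sq M (g0 (f n))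
    rw [hf.1, hf.1, ← hg2]; rfl
  have h3 : ∀ n, g (P.sigma n) = M.sigma (g n) := fun n => by
    change g0 (f _) = M.sigma (g0 (f n))
    rw [hf.2, hg3]
  refine ⟨M.θ 0 ∘ₗ g ∘ₗ s + g ∘ₗ s ∘ₗ P.θ 0, ?_, ?_⟩
  · rw [isHom_iff]
    constructor
    · intro m
      simp only [LinearMap.add_apply, LinearMap.comp_apply, map_add]
      have e1 : P.θ 0 (P.θ 0 (s m)) = s (P.θ 0 (P.θ 0 m)) := by
        have a1 := congrArg (P.θ 0) (hs m)
        have a2 := hs (P.θ 0 m)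
        rw [map_add] at a1
        have a3 := a1.trans a2.symm
        rw [add_comm] at a3
        exact add_left_cancel a3
      rw [← e1, h2, add_comm]
    · intro m
      simp only [LinearMap.add_apply, LinearMap.comp_apply, map_add]
      rw [sigma_theta, ← h3, ← h3, hσ, hσ, sigma_theta]
      simp
  · ext m
    simp only [LinearMap.add_apply, LinearMap.comp_apply, map_add]
    rw [hπ.1, h1, h1, ← hf.1, ← map_add, hs]

/-- induced module -/
def ind (P : GSupMod k (Fin 1)) : GSupMod k (Fin 1) :=
  mkS (P.carrier × P.carrier) (LinearMap.prodMap P.sigma (-P.sigma))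
    (LinearMap.prod (sq P ∘ₗ LinearMap.snd k P.carrier P.carrier)
      (LinearMap.fst k P.carrier P.carrier))
    (by rintro ⟨x, y⟩; simp [sigma_sigma]) (by rintro ⟨x, y⟩; simp [sigma_sq])

theorem ind_zcat {c : k} {P : GSupMod k (Fin 1)} (hP : ZCat k c P) : ZCat k c (ind P) := by
  refine zcat_transfer hP fun p hp => ?_
  apply LinearMap.ext
  intro v
  have h1 := aeval_intertwine (sq (ind P)) (sq P) (LinearMap.fst k P.carrier P.carrier)
    (fun v => rfl) p v
  have h2 := aeval_intertwine (sq (ind P)) (sq P) (LinearMap.snd k P.carrier P.carrier)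
    (fun v => rfl) p v
  rw [hp] at h1 h2
  exact Prod.ext h1 h2

theorem contr_of_isProjective {c : k} {P : GSupMod k (Fin 1)}
    (h : IsProjective (ZCat k c) P) : Contr P := by
  let π : P.carrier × P.carrier →ₗ[k] P.carrier := LinearMap.coprod LinearMap.id (P.θ 0)
  obtain ⟨g, hg, hπ⟩ := h.2 (ind P) P π LinearMap.id (ind_zcat h.1) h.1 (by
    refine (isHom_iff (ind P) P π).2 ⟨?_, ?_⟩
    · rintro ⟨x, y⟩
      change P.θ 0 (P.θ 0 y) + P.θ 0 x = P.θ 0 (x + P.θ 0 y)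
      rw [map_add, add_comm]
    · rintro ⟨x, y⟩
      erw [mkS_sigma]
      change P.sigma x + P.θ 0 (- P.sigma y) = P.sigma (x + P.θ 0 y)
      rw [map_add, sigma_theta, map_neg]) (fun x => ⟨(x, 0), by
        change x + P.θ 0 0 = x
        simp⟩)
      (by rw [isHom_iff]; simp)
  rw [isHom_iff] at hg
  refine ⟨LinearMap.snd k P.carrier P.carrier ∘ₗ g, fun m => ?_⟩
  have h1 := LinearMap.congr_fun hπ m
  have h2 := hg.1 m
  have h3 : (g (P.θ 0 m)).2 = (g m).1 := congrArg Prod.snd h2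
  change P.θ 0 (g m).2 + (g (P.θ 0 m)).2 = m
  rw [h3, add_comm]
  exact h1

theorem Contr.trace {P : GSupMod k (Fin 1)} (h : Contr P) :
    LinearMap.trace k P.carrier P.sigma = 0 := by
  obtain ⟨s, hs⟩ := h
  have h1 : P.sigma = (P.sigma ∘ₗ P.θ 0) ∘ₗ s + (P.sigma ∘ₗ s) ∘ₗ P.θ 0 := by
    ext m
    simp only [LinearMap.add_apply, LinearMap.comp_apply]
    rw [← map_add, hs]
  have h2 : P.sigma ∘ₗ P.θ 0 = -(P.θ 0 ∘ₗ P.sigma) := by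
    ext m; simp [sigma_theta]
  rw [h1, map_add, LinearMap.trace_comp_comm' (P.θ 0) (P.sigma ∘ₗ s), h2, ← LinearMap.comp_assoc,
    LinearMap.neg_comp, map_neg, neg_add_cancel]

theorem contr_of_exact {c : k} {P : GSupMod k (Fin 1)} (hP : ZCat k c P)
    (h : ∀ m, P.θ 0 m = 0 → ∃ n, m = P.θ 0 n) : Contr P := by
  -- a generalized inverse commuting with the square
  obtain ⟨g, hg, hgT⟩ : ∃ g : P.carrier →ₗ[k] P.carrier,
      (∀ m, P.θ 0 (g (P.θ 0 m)) = P.θ 0 m) ∧ ∀ m, g (sq P m) = sq P (g m) := by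
    obtain ⟨C, hC, hc⟩ := hP.1 (LinearMap.ker (P.θ 0)) (fun m hm => by
      rw [LinearMap.mem_ker] at hm ⊢
      rw [hm]; simp)
    obtain ⟨D, hD, hd⟩ := hP.1 (LinearMap.range (P.θ 0)) (fun m hm => ⟨_, rfl⟩)
    have hr : ∀ m ∈ LinearMap.range (P.θ 0), sq P m ∈ LinearMap.range (P.θ 0) :=
      fun m hm => ⟨_, rfl⟩
    obtain ⟨t, ht, htT⟩ := eqv_section (sq P) ((sq P).restrict hr) (P.θ 0).rangeRestrict
      (LinearMap.surjective_rangeRestrict _) (fun v => by ext; simp [sq]) C hC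
      (by rwa [LinearMap.ker_rangeRestrict])
    let pr := Submodule.projectionOnto _ D hd
    refine ⟨t ∘ₗ pr, fun m => ?_, fun m => ?_⟩
    · have h1 : pr (P.θ 0 m) = ⟨P.θ 0 m, ⟨m, rfl⟩⟩ :=
        Submodule.projectionOnto_apply_of_mem_left hd ⟨m, rfl⟩
      have := congrArg Subtype.val (ht ⟨P.θ 0 m, ⟨m, rfl⟩⟩)
      simp only [LinearMap.comp_apply, h1]
      exact this
    · have h1 : pr (sq P m) = (sq P).restrict hr (pr m) := by
        have : m ∈ LinearMap.range (P.θ 0) ⊔ D := by rw [hd.sup_eq_top]; trivial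
        obtain ⟨a, ha, b, hb, rfl⟩ := Submodule.mem_sup.1 this
        have e1 : pr a = ⟨a, ha⟩ := Submodule.projectionOnto_apply_of_mem_left hd ha
        have e2 : pr b = 0 := (Submodule.projectionOnto_apply_eq_zero_iff _).2 hb
        have e3 : pr (sq P a) = ⟨sq P a, hr a ha⟩ :=
          Submodule.projectionOnto_apply_of_mem_left hd (hr a ha)
        have e4 : pr (sq P b) = 0 := (Submodule.projectionOnto_apply_eq_zero_iff _).2 (hD b hb)
        rw [map_add, map_add, map_add, e1, e2, e3, e4, add_zero, add_zero]
        rfl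
      simp only [LinearMap.comp_apply, h1, htT]
  have hgT' : ∀ m, g (P.θ 0 (P.θ 0 m)) = P.θ 0 (P.θ 0 (g m)) := hgT
  let e : P.carrier →ₗ[k] P.carrier := P.θ 0 ∘ₗ g + g ∘ₗ P.θ 0
  have he : ∀ m, e m = P.θ 0 (g m) + g (P.θ 0 m) := fun m => rfl
  have heθ : ∀ m, e (P.θ 0 m) = P.θ 0 (e m) := fun m => by
    rw [he, he, map_add, hg, hgT', add_comm]
  have hinj : Function.Injective e := by
    rw [← LinearMap.ker_eq_bot, LinearMap.ker_eq_bot']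
    intro x hx
    have key : ∀ u, e u = 0 → g (P.θ 0 u) = u → u = 0 := by
      intro u h1 h2
      have h3 : P.θ 0 (g u) = -u := by
        rw [he, h2] at h1; exact eq_neg_of_add_eq_zero_left h1
      have h4 := hg (g u)
      rw [h3, map_neg, map_neg, h3, neg_neg] at h4
      exact eq_zero_of_eq_neg (k := k) h4
    have h1 : g (P.θ 0 x) = - P.θ 0 (g x) := by
      rw [he] at hx; exact eq_neg_of_add_eq_zero_right hx
    have h2 : P.θ 0 x = - P.θ 0 (P.θ 0 (g x)) := by
      rw [← hg x, h1, map_neg]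
    have hT : P.θ 0 (P.θ 0 x) = 0 := by
      apply key
      · rw [heθ, heθ, hx, map_zero, map_zero]
      · rw [hgT', h1, map_neg, map_neg, ← map_neg, ← h2]
    have h0 : P.θ 0 x = 0 := by
      rw [h2, ← hgT', hT, map_zero, neg_zero]
    obtain ⟨y, rfl⟩ := h x h0
    rw [he, hg, h0, map_zero, add_zero] at hx
    exact hx
  let E := LinearEquiv.ofInjectiveEndo e hinj
  have hE : ∀ x, e (E.symm x) = x := fun x => E.apply_symm_apply x
  refine ⟨g ∘ₗ E.symm.toLinearMap, fun m => ?_⟩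
  have hc : E.symm (P.θ 0 m) = P.θ 0 (E.symm m) := by
    apply hinj
    rw [hE, heθ, hE]
  change P.θ 0 (g (E.symm m)) + g (E.symm (P.θ 0 m)) = m
  rw [hc, ← he, hE]

end Proj

end SupCat

namespace SupCat

open GSupMod

section Classif

variable {k : Type} [Field k] [CharZero k]

theorem exists_split (M : GSupMod k (Fin 1)) : ∃ p : M.carrier →ₗ[k] M.carrier,
    (∀ m, p (M.θ 0 m) = 0) ∧ (∀ m, M.θ 0 (p m) = 0) ∧ (∀ m, p (p m) = p m) ∧
    (∀ m, p (M.sigma m) = M.sigma (p m)) ∧ ∀ m, M.θ 0 m = 0 → p m = 0 → ∃ n, m = M.θ 0 n := by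
  obtain ⟨p0, h1, h2, h3⟩ : ∃ p : M.carrier →ₗ[k] M.carrier,
      (∀ m, p (M.θ 0 m) = 0) ∧ (∀ m, M.θ 0 (p m) = 0) ∧
      ∀ m, M.θ 0 m = 0 → m - p m ∈ LinearMap.range (M.θ 0) := by
    obtain ⟨C0, hC0⟩ := Submodule.exists_isCompl (LinearMap.range (M.θ 0) ⊓ LinearMap.ker (M.θ 0))
    let C := C0 ⊓ LinearMap.ker (M.θ 0)
    have hd : Disjoint C (LinearMap.range (M.θ 0)) := by
      rw [Submodule.disjoint_def]
      intro x hx hx'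
      exact Submodule.disjoint_def.1 hC0.disjoint x ⟨hx', hx.2⟩ hx.1
    obtain ⟨D, hD, hCD⟩ := hd.symm.exists_isCompl
    have hCD' : IsCompl C D := hCD.symm
    refine ⟨C.projection D hCD', fun m => ?_, fun m => ?_, fun m hm => ?_⟩
    · exact (Submodule.projection_apply_eq_zero_iff hCD').2 (hD ⟨m, rfl⟩)
    · exact (Submodule.projection_apply_mem hCD' m).2
    · have : m ∈ (LinearMap.range (M.θ 0) ⊓ LinearMap.ker (M.θ 0)) ⊔ C0 := by
        rw [hC0.sup_eq_top]; trivial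
      obtain ⟨a, ha, b, hb, rfl⟩ := Submodule.mem_sup.1 this
      have ha2 : M.θ 0 a = 0 := ha.2
      have hbC : b ∈ C := ⟨hb, by
        rw [map_add, ha2, zero_add] at hm; exact hm⟩
      rw [map_add, (Submodule.projection_apply_eq_zero_iff hCD').2 (hD ha.1),
        Submodule.projection_apply_of_mem_left hCD' hbC]
      simpa using ha.1
  let p1 : M.carrier →ₗ[k] M.carrier := (2⁻¹ : k) • (p0 + M.sigma ∘ₗ p0 ∘ₗ M.sigma)
  have hp1 : ∀ m, p1 m = (2⁻¹ : k) • (p0 m + M.sigma (p0 (M.sigma m))) := fun _ => rfl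
  have g1 : ∀ m, p1 (M.θ 0 m) = 0 := fun m => by
    rw [hp1, sigma_theta, map_neg, h1, h1]; simp
  have g2 : ∀ m, M.θ 0 (p1 m) = 0 := fun m => by
    have : M.θ 0 (M.sigma (p0 (M.sigma m))) = 0 := by
      rw [← neg_neg (M.θ 0 _), ← sigma_theta, h2]; simp
    rw [hp1, map_smul, map_add, h2, this]; simp
  have g3 : ∀ m, M.θ 0 m = 0 → m - p1 m ∈ LinearMap.range (M.θ 0) := fun m hm => by
    have e1 : M.θ 0 (M.sigma m) = 0 := by
      rw [← neg_neg (M.θ 0 _), ← sigma_theta, hm]; simp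
    obtain ⟨x, hx⟩ := h3 m hm
    obtain ⟨y, hy⟩ := h3 _ e1
    refine ⟨(2⁻¹ : k) • (x - M.sigma y), ?_⟩
    have e2 : M.θ 0 (M.sigma y) = - (m - M.sigma (p0 (M.sigma m))) := by
      rw [← neg_neg (M.θ 0 _), ← sigma_theta, hy, map_sub, sigma_sigma]
    rw [map_smul, map_sub, hx, e2, hp1]
    have hm2 : ∀ w, m - (2⁻¹ : k) • w = (2⁻¹ : k) • ((m + m) - w) := fun w => by
      rw [smul_sub, half_add_half]
    rw [hm2]
    congr 1
    abel
  have g4 : ∀ m, p1 (M.sigma m) = M.sigma (p1 m) := fun m => by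
    rw [hp1, hp1, map_smul, map_add, sigma_sigma, sigma_sigma, add_comm]
  have g5 : ∀ m, p1 (p1 (p1 m)) = p1 (p1 m) := fun m => by
    obtain ⟨x, hx⟩ := g3 _ (g2 m)
    have := g1 x
    rw [hx, map_sub, sub_eq_zero] at this
    exact this.symm
  refine ⟨p1 ∘ₗ p1, fun m => ?_, fun m => ?_, fun m => ?_, fun m => ?_, fun m hm hpm => ?_⟩
  · simp [g1]
  · exact g2 _
  · simp only [LinearMap.comp_apply, g5]
  · simp only [LinearMap.comp_apply, g4]
  · obtain ⟨x, hx⟩ := g3 m hm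
    obtain ⟨y, hy⟩ := g3 _ (g2 m)
    have hpm' : p1 (p1 m) = 0 := hpm
    refine ⟨x + y, ?_⟩
    rw [map_add, hx, hy, hpm']; abel

theorem exists_decomp {c : k} {M : GSupMod k (Fin 1)} (hM : ZCat k c M) :
    ∃ V Q : GSupMod k (Fin 1), (∀ v, V.θ 0 v = 0) ∧ ZCat k c Q ∧ Contr Q ∧
    ∃ φ : M.carrier ≃ₗ[k] V.carrier × Q.carrier,
    (∀ s, φ (M.sigma s) = (V.sigma (φ s).1, Q.sigma (φ s).2)) ∧
    (∀ s, φ (M.θ 0 s) = (V.θ 0 (φ s).1, Q.θ 0 (φ s).2)) := by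
  obtain ⟨p, h1, h2, h3, h4, h5⟩ := exists_split M
  let V := sub M (LinearMap.range p) (by rintro _ ⟨x, rfl⟩; exact ⟨M.sigma x, h4 x⟩)
    (by rintro _ ⟨x, rfl⟩; rw [h2]; exact Submodule.zero_mem _)
  let Q := sub M (LinearMap.ker p)
    (by intro m hm; rw [LinearMap.mem_ker] at hm ⊢; rw [h4, hm, map_zero]) (fun m _ => h1 m)
  let iV : V.carrier →ₗ[k] M.carrier := (LinearMap.range p).subtype
  let iQ : Q.carrier →ₗ[k] M.carrier := (LinearMap.ker p).subtype
  have hVσ : ∀ v, iV (V.sigma v) = M.sigma (iV v) :=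
    fun v => congrArg Subtype.val (mkS_sigma (LinearMap.range p) _ _ _ _ v)
  have hQσ : ∀ v, iQ (Q.sigma v) = M.sigma (iQ v) :=
    fun v => congrArg Subtype.val (mkS_sigma (LinearMap.ker p) _ _ _ _ v)
  have hVθ : ∀ v, iV (V.θ 0 v) = M.θ 0 (iV v) := fun v => rfl
  have hQθ : ∀ v, iQ (Q.θ 0 v) = M.θ 0 (iQ v) := fun v => rfl
  have hQZ : ZCat k c Q := zcat_of_inj hM (LinearMap.ker p).subtype Subtype.val_injective
    (fun n => rfl)
  refine ⟨V, Q, ?_, hQZ, ?_, ?_⟩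
  · rintro ⟨_, x, rfl⟩
    exact Subtype.ext (h2 x)
  · refine contr_of_exact hQZ ?_
    rintro ⟨m, hm⟩ hθ
    obtain ⟨n, hn⟩ := h5 m (congrArg Subtype.val hθ) hm
    refine ⟨⟨n - p n, ?_⟩, ?_⟩
    · rw [LinearMap.mem_ker, map_sub, h3, sub_self]
    · refine Subtype.ext ?_
      change m = M.θ 0 (n - p n)
      rw [map_sub, h2, sub_zero, hn]
  · have hid : IsIdempotentElem p := LinearMap.ext h3
    have hc : IsCompl (LinearMap.range p) (LinearMap.ker p) :=
      LinearMap.IsIdempotentElem.isCompl hid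
    let E : (V.carrier × Q.carrier) ≃ₗ[k] M.carrier := Submodule.prodEquivOfIsCompl _ _ hc
    have hE : ∀ x, E x = iV x.1 + iQ x.2 := fun x =>
      Submodule.coe_prodEquivOfIsCompl' _ _ hc x
    refine ⟨E.symm, fun s => ?_, fun s => ?_⟩
    · obtain ⟨x, rfl⟩ := E.surjective s
      apply E.injective
      rw [E.symm_apply_apply, E.apply_symm_apply, hE, hE, map_add, hVσ, hQσ]
    · obtain ⟨x, rfl⟩ := E.surjective s
      apply E.injective
      rw [E.symm_apply_apply, E.apply_symm_apply, hE, hE, map_add, hVθ, hQθ]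

/-- superdimension -/
def sdim (M : GSupMod k (Fin 1)) : k := LinearMap.trace k M.carrier M.sigma

theorem trace_of_equiv {V W : Type*} [AddCommGroup V] [Module k V]
    [AddCommGroup W] [Module k W] (f : V →ₗ[k] V)
    (g : W →ₗ[k] W) (e : V ≃ₗ[k] W) (h : ∀ v, e (f v) = g (e v)) :
    LinearMap.trace k V f = LinearMap.trace k W g := by
  rw [← LinearMap.trace_conj' f e]
  congr 1
  ext w
  rw [LinearEquiv.conj_apply_apply, h, e.apply_symm_apply]

theorem sdim_dsum {A B S : GSupMod k (Fin 1)} (h : IsDsum A B S) : sdim S = sdim A + sdim B := by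
  obtain ⟨φ, h1, -⟩ := isDsum_elim h
  rw [sdim, trace_of_equiv S.sigma (LinearMap.prodMap A.sigma B.sigma) φ h1,
    LinearMap.trace_prodMap']
  rfl

theorem sdim_iso {A B : GSupMod k (Fin 1)} (h : Iso A B) : sdim A = sdim B := by
  obtain ⟨e, he⟩ := h
  rw [isHom_iff] at he
  exact trace_of_equiv _ _ e he.2

theorem sdim_proj {c : k} {P : GSupMod k (Fin 1)} (h : IsProjective (ZCat k c) P) : sdim P = 0 :=
  (contr_of_isProjective h).trace

theorem sdim_stIso {c : k} {M N : GSupMod k (Fin 1)} (h : StIso (ZCat k c) M N) :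
    sdim M = sdim N := by
  obtain ⟨P, Q, S, T, hP, hQ, hS, hT, hi⟩ := h
  have := sdim_iso hi
  rwa [sdim_dsum hS, sdim_dsum hT, sdim_proj hP, sdim_proj hQ, add_zero, add_zero] at this

theorem sdim_trivial {K : GSupMod k (Fin 1)} (h : IsTrivial false K) : sdim K = 1 := by
  obtain ⟨h1, -, h2⟩ := h
  have h2' : K.ev = ⊤ := by simpa using h2
  have : K.sigma = LinearMap.id := by
    ext m; exact sigma_of_ev (by rw [h2']; trivial)
  rw [sdim, this, LinearMap.trace_id, h1, Nat.cast_one]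

theorem sdim_tensor {M N T : GSupMod k (Fin 1)} (h : IsTensorObj M N T) :
    sdim T = sdim M * sdim N := by
  obtain ⟨φ, h0, h1, -⟩ := h
  rw [sdim, trace_of_equiv T.sigma (TensorProduct.map M.sigma N.sigma) φ,
    LinearMap.trace_tensorProduct']
  · rfl
  · intro v
    refine par_ext (φ.toLinearMap ∘ₗ T.sigma) (TensorProduct.map M.sigma N.sigma ∘ₗ φ.toLinearMap)
      ?_ ?_ v
    · intro m hm
      have hmem : φ m ∈ Submodule.map (φ : T.carrier →ₗ[k] _) T.ev := ⟨m, hm, rfl⟩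
      rw [h0] at hmem
      simp only [LinearMap.comp_apply, sigma_of_ev hm, LinearEquiv.coe_coe]
      generalize φ m = w at hmem ⊢
      induction hmem using Submodule.span_induction with
      | mem x hx =>
        rcases hx with ⟨a, ha, b, hb, rfl⟩ | ⟨a, ha, b, hb, rfl⟩
        · simp [sigma_of_ev ha, sigma_of_ev hb]
        · simp [sigma_of_od ha, sigma_of_od hb, TensorProduct.neg_tmul, TensorProduct.tmul_neg]
      | zero => simp
      | add x y _ _ hx hy => rw [map_add, ← hx, ← hy]
      | smul a x _ hx => rw [map_smul, ← hx]
    · intro m hm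
      have hmem : φ m ∈ Submodule.map (φ : T.carrier →ₗ[k] _) T.od := ⟨m, hm, rfl⟩
      rw [h1] at hmem
      simp only [LinearMap.comp_apply, sigma_of_od hm, LinearEquiv.coe_coe, map_neg]
      generalize φ m = w at hmem ⊢
      induction hmem using Submodule.span_induction with
      | mem x hx =>
        rcases hx with ⟨a, ha, b, hb, rfl⟩ | ⟨a, ha, b, hb, rfl⟩
        · simp [sigma_of_ev ha, sigma_of_od hb, TensorProduct.tmul_neg]
        · simp [sigma_of_od ha, sigma_of_ev hb, TensorProduct.neg_tmul]
      | zero => simp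
      | add x y _ _ hx hy => rw [map_add, ← hx, ← hy, neg_add]
      | smul a x _ hx => rw [map_smul, ← hx, smul_neg]

theorem sdim_dual {M D : GSupMod k (Fin 1)} (h : IsDualObj M D) : sdim D = sdim M := by
  obtain ⟨φ, h0, h1, -⟩ := h
  rw [sdim, sdim, ← LinearMap.trace_transpose' M.sigma]
  refine trace_of_equiv _ _ φ ?_
  intro v
  refine par_ext (φ.toLinearMap ∘ₗ D.sigma) (Module.Dual.transpose M.sigma ∘ₗ φ.toLinearMap)
      ?_ ?_ v
  · intro d hd
    have hd' := (h0 d).1 hd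
    simp only [LinearMap.comp_apply, sigma_of_ev hd, LinearEquiv.coe_coe]
    ext m
    refine par_ext (φ d) (Module.Dual.transpose M.sigma (φ d)) ?_ ?_ m
    · intro m hm; simp [Module.Dual.transpose_apply, sigma_of_ev hm]
    · intro m hm; simp [Module.Dual.transpose_apply, sigma_of_od hm, hd' m hm]
  · intro d hd
    have hd' := (h1 d).1 hd
    simp only [LinearMap.comp_apply, sigma_of_od hd, LinearEquiv.coe_coe]
    ext m
    refine par_ext (φ (-d)) (Module.Dual.transpose M.sigma (φ d)) ?_ ?_ m
    · intro m hm; simp [Module.Dual.transpose_apply, sigma_of_ev hm, hd' m hm]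
    · intro m hm; simp [Module.Dual.transpose_apply, sigma_of_od hm]

theorem sdim_hom {M H : GSupMod k (Fin 1)} (h : IsHomObj M M H) : sdim H = sdim M * sdim M := by
  obtain ⟨φ, h0, h1, -⟩ := h
  let c : (M.carrier →ₗ[k] M.carrier) →ₗ[k] (M.carrier →ₗ[k] M.carrier) :=
    LinearMap.mulLeft k (A := Module.End k M.carrier) M.sigma ∘ₗ
      LinearMap.mulRight k (A := Module.End k M.carrier) M.sigma
  have hc : ∀ f m, c f m = M.sigma (f (M.sigma m)) := fun f m => rfl
  have e1 : LinearMap.trace k H.carrier H.sigma = LinearMap.trace k _ c := by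
    refine trace_of_equiv _ _ φ fun v => ?_
    refine par_ext (φ.toLinearMap ∘ₗ H.sigma) (c ∘ₗ φ.toLinearMap) ?_ ?_ v
    · intro d hd
      obtain ⟨a1, a2⟩ := (h0 d).1 hd
      simp only [LinearMap.comp_apply, sigma_of_ev hd, LinearEquiv.coe_coe]
      refine LinearMap.ext fun m => par_ext (φ d) (c (φ d)) ?_ ?_ m
      · intro m hm; simp [hc, sigma_of_ev hm, sigma_of_ev (a1 m hm)]
      · intro m hm; simp [hc, sigma_of_od hm, sigma_of_od (a2 m hm)]
    · intro d hd
      obtain ⟨a1, a2⟩ := (h1 d).1 hd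
      simp only [LinearMap.comp_apply, sigma_of_od hd, LinearEquiv.coe_coe]
      refine LinearMap.ext fun m => par_ext (φ (-d)) (c (φ d)) ?_ ?_ m
      · intro m hm; simp [hc, sigma_of_ev hm, sigma_of_od (a1 m hm)]
      · intro m hm; simp [hc, sigma_of_od hm, sigma_of_ev (a2 m hm)]
  have e2 : LinearMap.trace k _ (TensorProduct.map (Module.Dual.transpose M.sigma) M.sigma) =
      LinearMap.trace k _ c := by
    refine trace_of_equiv (V := TensorProduct k (Module.Dual k M.carrier) M.carrier)
      (W := M.carrier →ₗ[k] M.carrier) _ _ (dualTensorHomEquiv k M.carrier M.carrier) fun v => ?_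
    induction v using TensorProduct.induction_on with
    | zero => simp
    | add x y hx hy => rw [map_add, map_add, map_add, map_add, hx, hy]
    | tmul x y =>
      refine LinearMap.ext fun m => ?_
      rw [hc]
      simp [dualTensorHomEquiv, Module.Dual.transpose_apply, dualTensorHom_apply]
  rw [sdim, e1, ← e2, LinearMap.trace_tensorProduct', LinearMap.trace_transpose']
  rfl

theorem sdim_endo {c : k} {M : GSupMod k (Fin 1)} (h : IsEndotrivial (ZCat k c) M) :
    sdim M = 1 ∨ sdim M = -1 := by
  obtain ⟨-, H, K, P, S, hH, -, hK, hP, hS, hi⟩ := h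
  rw [← mul_self_eq_one_iff, ← sdim_hom hH, sdim_iso hi, sdim_dsum hS, sdim_trivial hK,
    sdim_proj hP, add_zero]

theorem finrank_le_one {c : k} {M V Q : GSupMod k (Fin 1)} (h : IsEndotrivial (ZCat k c) M)
    (hV : ∀ v, V.θ 0 v = 0) (φ : M.carrier ≃ₗ[k] V.carrier × Q.carrier)
    (hφ : ∀ s, φ (M.θ 0 s) = (V.θ 0 (φ s).1, Q.θ 0 (φ s).2)) :
    Module.finrank k V.carrier ≤ 1 := by
  obtain ⟨-, H, K, P, S, ⟨ψ, -, -, hψ⟩, -, hK, hP, hS, ⟨e, he⟩⟩ := h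
  obtain ⟨δ, -, hδ⟩ := isDsum_elim hS
  obtain ⟨s, hs⟩ := contr_of_isProjective hP
  rw [isHom_iff] at he
  have he1 : ∀ m, e (H.θ 0 m) = S.θ 0 (e m) := he.1
  let i : V.carrier →ₗ[k] M.carrier := φ.symm.toLinearMap ∘ₗ LinearMap.inl k V.carrier Q.carrier
  let p : M.carrier →ₗ[k] V.carrier := LinearMap.fst k V.carrier Q.carrier ∘ₗ φ.toLinearMap
  have hp : ∀ m, p (M.θ 0 m) = 0 := fun m => by
    change (φ (M.θ 0 m)).1 = 0
    rw [hφ, hV]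
  have hi : ∀ v, M.θ 0 (i v) = 0 := fun v => by
    apply φ.injective
    rw [hφ, hV]
    change ((0 : V.carrier), Q.θ 0 (φ (φ.symm (v, 0))).2) = _
    rw [φ.apply_symm_apply]
    simp
  have hpi : ∀ v, p (i v) = v := fun v => by
    change (φ (φ.symm (v, 0))).1 = v
    rw [φ.apply_symm_apply]
  let G : (V.carrier →ₗ[k] V.carrier) →ₗ[k] (M.carrier →ₗ[k] M.carrier) :=
    (LinearMap.llcomp k M.carrier V.carrier M.carrier i) ∘ₗ
      (LinearMap.lcomp k V.carrier p)
  have hG : ∀ f m, G f m = i (f (p m)) := fun f m => rfl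
  let L : (V.carrier →ₗ[k] V.carrier) →ₗ[k] K.carrier :=
    LinearMap.fst k K.carrier P.carrier ∘ₗ δ.toLinearMap ∘ₗ e.toLinearMap ∘ₗ
      ψ.symm.toLinearMap ∘ₗ G
  have hL : ∀ f, L f = (δ (e (ψ.symm (G f)))).1 := fun f => rfl
  have hinj : Function.Injective L := by
    rw [← LinearMap.ker_eq_bot, LinearMap.ker_eq_bot']
    intro f hf
    rw [hL] at hf
    have h0 : H.θ 0 (ψ.symm (G f)) = 0 := by
      apply ψ.injective
      rw [hψ, ψ.apply_symm_apply, map_zero]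
      ext m
      simp [hG, hi, sigma_theta, hp]
    have h1 : P.θ 0 (δ (e (ψ.symm (G f)))).2 = 0 := by
      have := hδ (e (ψ.symm (G f)))
      rw [← he1, h0, map_zero, map_zero] at this
      exact (congrArg Prod.snd this).symm
    have h2 := hs (δ (e (ψ.symm (G f)))).2
    rw [h1, map_zero, add_zero] at h2
    set q := s (δ (e (ψ.symm (G f)))).2 with hq
    have h3 : ψ.symm (G f) = H.θ 0 (e.symm (δ.symm (0, q))) := by
      apply e.injective
      apply δ.injective
      rw [he1, e.apply_symm_apply, hδ, δ.apply_symm_apply]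
      ext
      · rw [hf, map_zero]
      · exact h2.symm
    have h4 : G f = ψ (H.θ 0 (e.symm (δ.symm (0, q)))) := by rw [← h3, ψ.apply_symm_apply]
    rw [hψ] at h4
    ext v
    have h5 := congrArg p (LinearMap.congr_fun h4 (i v))
    rw [hG, hpi, hpi] at h5
    rw [h5]
    simp [hp, hi]
  have := LinearMap.finrank_le_finrank_of_injective hinj
  rw [Module.finrank_linearMap, hK.1] at this
  nlinarith

end Classif

end SupCat

namespace SupCat

open GSupMod

section Final

variable {k : Type} [Field k] [CharZero k]

theorem sigma_of_finrank_one {V : GSupMod k (Fin 1)} (h : Module.finrank k V.carrier = 1)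
    (v : V.carrier) : V.sigma v = sdim V • v := by
  obtain ⟨u, -, hu⟩ := finrank_eq_one_iff'.1 h
  obtain ⟨a, ha⟩ := hu (V.sigma u)
  have h1 : V.sigma = a • LinearMap.id := by
    ext w
    obtain ⟨b, rfl⟩ := hu w
    rw [map_smul, ← ha]
    simp [smul_smul, mul_comm]
  have h2 : sdim V = a := by
    rw [sdim, h1, map_smul, LinearMap.trace_id, h]; simp
  rw [h2, h1]; rfl

theorem endo_decomp {c : k} {M : GSupMod k (Fin 1)} (h : IsEndotrivial (ZCat k c) M) :
    ∃ V Q : GSupMod k (Fin 1), (∀ v, V.θ 0 v = 0) ∧ IsProjective (ZCat k c) Q ∧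
    Module.finrank k V.carrier = 1 ∧ sdim V = sdim M ∧
    ∃ φ : M.carrier ≃ₗ[k] V.carrier × Q.carrier,
    (∀ s, φ (M.sigma s) = (V.sigma (φ s).1, Q.sigma (φ s).2)) ∧
    (∀ s, φ (M.θ 0 s) = (V.θ 0 (φ s).1, Q.θ 0 (φ s).2)) := by
  obtain ⟨V, Q, hV, hQ, hc, φ, h1, h2⟩ := exists_decomp h.1
  have hs : sdim V = sdim M := by
    have hq : sdim Q = 0 := hc.trace
    rw [sdim_dsum (isDsum_of V Q M φ h1 h2), hq, add_zero]
  refine ⟨V, Q, hV, isProjective_of_contr hQ hc, ?_, hs, φ, h1, h2⟩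
  have hle := finrank_le_one h hV φ h2
  have hne : Module.finrank k V.carrier ≠ 0 := by
    intro h0
    have := Module.finrank_zero_iff.1 h0
    have h3 : V.sigma = 0 := by ext v; exact Subsingleton.elim _ _
    have h4 : sdim V = 0 := by rw [sdim, h3, map_zero]
    rw [hs] at h4
    rcases sdim_endo h with h5 | h5 <;> rw [h4] at h5 <;> simp at h5
  omega

theorem stIso_of_sdim {c : k} {M N : GSupMod k (Fin 1)} (hM : IsEndotrivial (ZCat k c) M)
    (hN : IsEndotrivial (ZCat k c) N) (h : sdim M = sdim N) : StIso (ZCat k c) M N := by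
  obtain ⟨V, P, hV, hP, hV1, hVs, φ, h1, h2⟩ := endo_decomp hM
  obtain ⟨W, Q, hW, hQ, hW1, hWs, ψ, g1, g2⟩ := endo_decomp hN
  refine ⟨Q, P, dsum M Q, dsum N P, hQ, hP, isDsum_dsum _ _, isDsum_dsum _ _, ?_⟩
  let e : V.carrier ≃ₗ[k] W.carrier := LinearEquiv.ofFinrankEq _ _ (hV1.trans hW1.symm)
  have he : ∀ v, e (V.sigma v) = W.sigma (e v) := fun v => by
    rw [sigma_of_finrank_one hV1, sigma_of_finrank_one hW1, map_smul, hVs, hWs, h]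
  let E : (M.carrier × Q.carrier) ≃ₗ[k] (N.carrier × P.carrier) :=
    { toFun := fun x => (ψ.symm (e (φ x.1).1, x.2), (φ x.1).2)
      map_add' := by
        rintro ⟨x, y⟩ ⟨x', y'⟩
        ext
        · simp only [Prod.fst_add, Prod.snd_add, map_add]
          exact map_add ψ.symm (_, y) (_, y')
        · simp
      map_smul' := by
        rintro a ⟨x, y⟩
        ext
        · simp only [Prod.smul_fst, Prod.smul_snd, map_smul, RingHom.id_apply]
          exact map_smul ψ.symm a (_, y)
        · simp
      invFun := fun y => (φ.symm (e.symm (ψ y.1).1, y.2), (ψ y.1).2)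
      left_inv := by rintro ⟨x, y⟩; simp
      right_inv := by rintro ⟨x, y⟩; simp }
  have hE : ∀ x y, E (x, y) = (ψ.symm (e (φ x).1, y), (φ x).2) := fun _ _ => rfl
  refine ⟨E, (isHom_iff (dsum M Q) (dsum N P) E.toLinearMap).2 ⟨?_, ?_⟩⟩
  · rintro ⟨x, y⟩
    change E (M.θ 0 x, Q.θ 0 y) = (N.θ 0 (E (x, y)).1, P.θ 0 (E (x, y)).2)
    rw [hE, hE, h2]
    ext
    · apply ψ.injective
      simp [g2, hV, hW]
    · rfl
  · rintro ⟨x, y⟩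
    have a1 : (dsum M Q).sigma (x, y) = (M.sigma x, Q.sigma y) :=
      mkS_sigma (M.carrier × Q.carrier) _ _ _ _ (x, y)
    have a2 : (dsum N P).sigma (E (x, y)) = (N.sigma (E (x, y)).1, P.sigma (E (x, y)).2) :=
      mkS_sigma (N.carrier × P.carrier) _ _ _ _ (E (x, y))
    refine (congrArg E a1).trans (Eq.trans ?_ a2.symm)
    rw [hE, hE, h1]
    ext
    · apply ψ.injective
      simp [g1, he]
    · rfl

/-- one-dimensional modules -/
def kmod (ε : k) (hε : ε * ε = 1) : GSupMod k (Fin 1) :=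
  mkS k (ε • LinearMap.id) 0 (by intro v; simp [← mul_assoc, hε]) (by intro v; simp)

theorem kmod_sigma (ε : k) (hε : ε * ε = 1) (v : k) : (kmod ε hε).sigma v = ε * v :=
  mkS_sigma k _ _ _ _ v

theorem kmod_sdim (ε : k) (hε : ε * ε = 1) : sdim (kmod ε hε) = ε := by
  have : (kmod ε hε).sigma = ε • (LinearMap.id : k →ₗ[k] k) :=
    LinearMap.ext fun v => kmod_sigma ε hε v
  rw [sdim, this]
  change LinearMap.trace k k _ = _
  rw [map_smul, LinearMap.trace_id]; simp

theorem zcat_of_zero (c : k) {M : GSupMod k (Fin 1)} (h : M.θ 0 = 0) : ZCat k c M := by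
  have : sq M = 0 := by rw [sq, h]; simp
  rw [zcat_iff, this]
  exact ⟨Module.End.isSemisimple_zero, fun _ => rfl⟩

/-- the zero module -/
def zmod : GSupMod k (Fin 1) := mkS PUnit 0 0 (fun _ => rfl) (fun _ => rfl)

theorem kmod_homObj (ε : k) (hε : ε * ε = 1) :
    IsHomObj (kmod ε hε) (kmod ε hε) (kmod (1 : k) (one_mul 1)) := by
  let φ : k ≃ₗ[k] (k →ₗ[k] k) := (LinearMap.ringLmapEquivSelf k k k).symm
  have hφ : ∀ h m : k, φ h m = h • m := fun h m => by simp [φ, mul_comm]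
  refine ⟨φ, fun (h : k) => ?_, fun (h : k) => ?_, fun i h => ?_⟩
  · refine ⟨fun _ => ⟨fun (m : k) hm => ?_, fun (m : k) hm => ?_⟩, fun _ => ?_⟩
    · exact (hφ h m).symm ▸ (kmod ε hε).ev.smul_mem h hm
    · exact (hφ h m).symm ▸ (kmod ε hε).od.smul_mem h hm
    · refine (mem_ev_iff (kmod (1 : k) (one_mul 1)) h).2 ?_
      exact (kmod_sigma 1 _ h).trans (one_mul h)
  · constructor
    · intro hh
      replace hh := (mem_od_iff (kmod (1 : k) (one_mul 1)) h).1 hh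
      have h0 : h = 0 := by
        have h1 : h = -h := by
          have := kmod_sigma (1 : k) (one_mul 1) h
          rw [one_mul] at this
          exact this.symm.trans hh
        exact eq_zero_of_eq_neg (k := k) h1
      have h2 : ∀ m : k, φ h m = 0 := fun m => by rw [hφ, h0]; simp
      refine ⟨fun (m : k) hm => ?_, fun (m : k) hm => ?_⟩
      · exact (h2 m).symm ▸ (kmod ε hε).od.zero_mem
      · exact (h2 m).symm ▸ (kmod ε hε).ev.zero_mem
    · rintro ⟨h0, h1⟩
      obtain ⟨a, ha, b, hb, hab⟩ := par_decomp (kmod ε hε) (1 : k)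
      have e1 : h • a = 0 :=
        Submodule.disjoint_def.1 (kmod ε hε).isCompl.disjoint _
          ((kmod ε hε).ev.smul_mem h ha) ((hφ h a) ▸ h0 a ha)
      have e2 : h • b = 0 :=
        Submodule.disjoint_def.1 (kmod ε hε).isCompl.disjoint _
          ((hφ h b) ▸ h1 b hb) ((kmod ε hε).od.smul_mem h hb)
      have e3 : h = 0 := by
        have : h • (a + b) = 0 := by rw [smul_add, e1, e2, add_zero]
        rw [← hab] at this
        exact (mul_one h).symm.trans this
      rw [e3]
      exact Submodule.zero_mem _
  · refine LinearMap.ext fun (m : k) => ?_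
    have e0 : (kmod ε hε).sigma (0 : k) = (0 : k) := (kmod_sigma ε hε 0).trans (mul_zero ε)
    have e1 : φ h ((kmod ε hε).sigma (0 : k) : k) = 0 := by
      refine (congrArg (φ h) e0).trans ?_
      exact (φ h).map_zero
    have e2 : (kmod ε hε).sigma (φ h ((kmod ε hε).sigma (0 : k) : k) : k) = (0 : k) :=
      (congrArg (kmod ε hε).sigma e1).trans e0
    have e3 : φ (0 : k) m = (0 : k) := by rw [hφ, zero_smul]
    refine e3.trans ?_
    refine Eq.symm ?_
    refine (congrArg (fun t : k => (0 : k) - t) e2).trans ?_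
    exact sub_zero 0

theorem kmod_endo (c ε : k) (hε : ε * ε = 1) : IsEndotrivial (ZCat k c) (kmod ε hε) := by
  refine ⟨zcat_of_zero c rfl, kmod 1 (one_mul 1), kmod 1 (one_mul 1), zmod, kmod 1 (one_mul 1),
    kmod_homObj ε hε, zcat_of_zero c rfl, ⟨Module.finrank_self k, fun _ => rfl, ?_⟩, ?_, ?_, ?_⟩
  · simp only [Bool.false_eq_true, if_false]
    rw [eq_top_iff]
    intro (x : k) _
    refine (mem_ev_iff (kmod (1 : k) (one_mul 1)) x).2 ?_
    exact (kmod_sigma 1 _ x).trans (one_mul x)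
  · exact isProjective_of_contr (zcat_of_zero c rfl) ⟨0, fun m => rfl⟩
  · let φ : k ≃ₗ[k] k × PUnit := LinearEquiv.prodUnique.symm
    exact isDsum_of (kmod 1 (one_mul 1)) zmod (kmod 1 (one_mul 1)) φ (fun s => rfl) (fun s => rfl)
  · exact ⟨LinearEquiv.refl k _, (isHom_iff _ _ _).2 ⟨fun _ => rfl, fun _ => rfl⟩⟩

/-- the invariant -/
def inv2 (x : k) : ZMod 2 := by
  classical exact if x = 1 then 0 else 1

theorem inv2_one : inv2 (1 : k) = 0 := by simp [inv2]

theorem inv2_neg_one : inv2 (-1 : k) = 1 := by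
  have : (-1 : k) ≠ 1 := fun h => one_ne_zero (eq_zero_of_eq_neg (k := k) h.symm)
  simp [inv2, this]

theorem inv2_mul {x y : k} (hx : x = 1 ∨ x = -1) (hy : y = 1 ∨ y = -1) :
    inv2 (x * y) = inv2 x + inv2 y := by
  rcases hx with rfl | rfl <;> rcases hy with rfl | rfl <;>
    simp [inv2_one, inv2_neg_one] <;> decide

theorem inv2_inj {x y : k} (hx : x = 1 ∨ x = -1) (hy : y = 1 ∨ y = -1) (h : inv2 x = inv2 y) :
    x = y := by
  rcases hx with rfl | rfl <;> rcases hy with rfl | rfl <;>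
    simp [inv2_one, inv2_neg_one] at h ⊢

/-- the isomorphism -/
def tmap (c : k) : TGrp (ZCat k c) → ZMod 2 :=
  Quot.lift (fun M => inv2 (sdim M.1)) (fun M N h => by
    have : sdim M.1 = sdim N.1 := sdim_stIso h
    simp only [this])

theorem tmap_mk (c : k) (M) : tmap c (tmk (ZCat k c) M) = inv2 (sdim M.1) := rfl

theorem tmap_bij (c : k) : Function.Bijective (tmap c) := by
  constructor
  · rintro ⟨M⟩ ⟨N⟩ h
    exact Quot.sound (stIso_of_sdim M.2 N.2 (inv2_inj (sdim_endo M.2) (sdim_endo N.2) h))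
  · intro z
    have h1 : tmap c (tmk _ ⟨_, kmod_endo c 1 (one_mul 1)⟩) = 0 := by
      rw [tmap_mk, kmod_sdim, inv2_one]
    have h2 : tmap c (tmk _ ⟨_, kmod_endo c (-1) (by simp)⟩) = 1 := by
      rw [tmap_mk, kmod_sdim, inv2_neg_one]
    fin_cases z
    · exact ⟨_, h1⟩
    · exact ⟨_, h2⟩

/-- the group structure -/
def tdata (c : k) : TGroupData (ZCat k c) :=
  let e := Equiv.ofBijective (tmap c) (tmap_bij c)
  have he : ∀ x, tmap c (e.symm x) = x := fun x => e.apply_symm_apply x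
  { mul := fun x y => e.symm (tmap c x + tmap c y)
    one := e.symm 0
    inv := fun x => e.symm (- tmap c x)
    mul_assoc := fun x y z => by rw [he, he, add_assoc]
    mul_comm := fun x y => by rw [add_comm]
    one_mul := fun x => by
      rw [he, zero_add]; exact e.symm_apply_apply x
    inv_mul := fun x => by rw [he, neg_add_cancel]
    mul_spec := fun M N T h hT => by
      apply (tmap_bij c).1
      rw [he, tmap_mk, tmap_mk, tmap_mk, sdim_tensor h, inv2_mul (sdim_endo M.2) (sdim_endo N.2)]
    one_spec := fun K h hK => by
      apply (tmap_bij c).1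
      rw [he, tmap_mk, sdim_trivial h, inv2_one]
    inv_spec := fun M D h hD => by
      apply (tmap_bij c).1
      rw [he, tmap_mk, tmap_mk, sdim_dual h]
      generalize inv2 (sdim M.1) = z
      revert z; decide }

end Final

end SupCat


open SupCat SupCat.GSupMod in
/-- Let `z = a•x + b•y` be a nonzero element of the odd
part of `sl(1|1)` and let `⟨z⟩` denote the rank `1` subalgebra of `sl(1|1)`
generated by `z`.  Then the group of endotrivial modules `T(⟨z⟩)` is
isomorphic to `ℤ/2ℤ`.  (The group structure on the stable classes of
endotrivial modules in `F(⟨z⟩)` — which depends on `z` only through the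
product `a·b` — is induced by the tensor product.) -/
theorem T_of_rank_one_subalgebra_of_sl11_is_Z2
    (k : Type) [Field k] [IsAlgClosed k] [CharZero k]
    (a b : k) (hz : ¬(a = 0 ∧ b = 0)) :
    ∃ (G : TGroupData (ZCat k (a * b)))
      (φ : TGrp (ZCat k (a * b)) → ZMod 2),
      Function.Bijective φ ∧
      ∀ x y, φ (G.mul x y) = φ x + φ y := by
  exact ⟨tdata (a * b), tmap (a * b), tmap_bij (a * b), fun x y =>
    (Equiv.ofBijective (tmap (a * b)) (tmap_bij (a * b))).apply_symm_apply _⟩
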